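/- The quiver Hall-Littlewood series is the iterated shuffle product of Schur polynomials: χ^{𝐢,𝐚}_{μ(•)} = s_{μ(1)}(x(1)) ⋆ s_{μ(2)}(x(2)) ⋆ ⋯ ⋆ s_{μ(m)}(x(m)), where for each k the factor s_{μ(k)}(x(k)) = J(x(k)^{μ(k)+ρ_{a_k}})/J(x(k)^{ρ_{a_k}}) is the Schur (Laurent) polynomial in the a_k variables of block x(k), regarded as a symmetric Laurent polynomial for the dimension vector whose value is a_k at vertex i_k and 0 elsewhere, and the iterated ⋆ products are formed left to right in these disjoint blocks of variables. -/

import Mathlib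

open scoped BigOperators

namespace QKS

/-- The coordinates of `X• = ∏_i ℤ^{ν^{(i)}}`, indexed by their block `k` (with `i_k = i`)
and position `p` within the block.  The coordinates at vertex `i` are those with
`iseq k = i`, ordered lexicographically by `(k, p)`. -/
abbrev Coord (m : ℕ) (a : Fin m → ℕ) : Type := (k : Fin m) × Fin (a k)

/-- The (strict) order on coordinates: lexicographic by block, then position. -/
abbrev coordLT {m : ℕ} {a : Fin m → ℕ} (x y : Coord m a) : Prop :=
  x.1 < y.1 ∨ (x.1 = y.1 ∧ (x.2 : ℕ) < (y.2 : ℕ))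

variable {Q0 Q1 : Type} [Fintype Q0] [Fintype Q1] [DecidableEq Q0] [DecidableEq Q1]
variable {m : ℕ}

/-- The staircase `ρ• ∈ X•`: at each vertex, its coordinates are
`ν^{(i)} - 1, ν^{(i)} - 2, …, 1, 0` read in the order of the coordinates at that vertex;
equivalently, `ρ x` is the number of coordinates at the vertex of `x` that are greater
than `x`. -/
def rho (iseq : Fin m → Q0) (a : Fin m → ℕ) : Coord m a → ℤ := fun x =>
  ((Finset.univ.filter (fun y : Coord m a => iseq y.1 = iseq x.1 ∧ coordLT x y)).card : ℤ)

/-- The index set `R_{𝐢,𝐚}`: triples (arrow `b`, coordinate `(k,p)`, coordinate `(ℓ,q)`)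
with `k < ℓ`, `tb = i_k` and `hb = i_ℓ`. -/
abbrev RootSet (hd tl : Q1 → Q0) (iseq : Fin m → Q0) (a : Fin m → ℕ) : Type :=
  {z : Q1 × Coord m a × Coord m a //
    z.2.1.1 < z.2.2.1 ∧ tl z.1 = iseq z.2.1.1 ∧ hd z.1 = iseq z.2.2.1}

/-- `ᾱ = e(ℓ)_q − e(k)_p ∈ X•` for a root `α = α^b_{p,q}(k,ℓ)`. -/
def alphaBar {hd tl : Q1 → Q0} {iseq : Fin m → Q0} {a : Fin m → ℕ}
    (z : RootSet hd tl iseq a) : Coord m a → ℤ := fun x =>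
  (if x = z.1.2.2 then 1 else 0) - (if x = z.1.2.1 then 1 else 0)

/-- The group `S• = ∏_i S_{ν^{(i)}}`, realized as permutations of the coordinates
preserving the vertex. -/
abbrev VertexPerm (iseq : Fin m → Q0) (a : Fin m → ℕ) : Type :=
  {σ : Equiv.Perm (Coord m a) // ∀ x : Coord m a, iseq (σ x).1 = iseq x.1}

/-- The quiver Kostka-Shoji polynomial `𝒦^{𝐢,𝐚}_{λ•,μ(•)}(t_{Q₁})`, defined by the signed
sum over `w• ∈ S•` of, for each `w•`, the (finite) sum of the monomials
`∏_α t_α^{m(α)}` over all Kostant partitions `m : R_{𝐢,𝐚} → ℤ_{≥0}` with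
`Σ_α m(α) ᾱ = (w•)⁻¹(λ•+ρ•) − (μ•+ρ•)`. -/
noncomputable def KS (hd tl : Q1 → Q0) (iseq : Fin m → Q0) (a : Fin m → ℕ)
    (lam mu : Coord m a → ℤ) : MvPolynomial Q1 ℤ :=
  ∑ σ : VertexPerm iseq a,
    ((Equiv.Perm.sign σ.1 : ℤˣ) : ℤ) •
      ∑ᶠ f : {f : RootSet hd tl iseq a → ℕ //
          ∀ x : Coord m a,
            (∑ α : RootSet hd tl iseq a, (f α : ℤ) * alphaBar α x)
              = (lam (σ.1 x) + rho iseq a (σ.1 x)) - (mu x + rho iseq a x)},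
        ∏ α : RootSet hd tl iseq a, MvPolynomial.X α.1.1 ^ f.1 α

/-- `μ(•)` is a sequence of weakly decreasing vectors `μ(k) ∈ ℤ^{a_k}`. -/
def BlockDecreasing {a : Fin m → ℕ} (mu : Coord m a → ℤ) : Prop :=
  ∀ (k : Fin m) (p q : Fin (a k)), p ≤ q → mu ⟨k, q⟩ ≤ mu ⟨k, p⟩

/-- `λ•` is a tuple of weakly decreasing vectors `λ^{(i)} ∈ ℤ^{ν^{(i)}}`: weakly decreasing
along the coordinates of each vertex. -/
def VertexDecreasing (iseq : Fin m → Q0) {a : Fin m → ℕ} (lam : Coord m a → ℤ) : Prop :=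
  ∀ x y : Coord m a, iseq x.1 = iseq y.1 → coordLT x y → lam y ≤ lam x

end QKS

open scoped BigOperators

namespace Shuffle

noncomputable section

/-- The field of rational functions in the variables indexed by `V`: the fraction field of
the multivariate polynomial ring.  Laurent polynomials in the variables `X v` are viewed
inside this field, and the geometric series `(1 - t·x/y)⁻¹` is the honest inverse here. -/
abbrev FF (V : Type) : Type := FractionRing (MvPolynomial V ℚ)

/-- The variable `X v`, viewed in the rational function field. -/
def xv {V : Type} (v : V) : FF V := algebraMap (MvPolynomial V ℚ) (FF V) (MvPolynomial.X v)

/-- The action of a permutation of the variables on the rational function field,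
by renaming variables. -/
def act {V : Type} (σ : Equiv.Perm V) : FF V →+* FF V :=
  IsFractionRing.lift (g := (algebraMap (MvPolynomial V ℚ) (FF V)).comp
      (MvPolynomial.rename σ : MvPolynomial V ℚ →ₐ[ℚ] MvPolynomial V ℚ).toRingHom)
    ((IsFractionRing.injective (MvPolynomial V ℚ) (FF V)).comp
      (MvPolynomial.rename_injective σ σ.injective))

variable {X Q0 Q1 : Type} [Fintype X] [DecidableEq X] [Fintype Q0] [DecidableEq Q0]
  [Fintype Q1] [DecidableEq Q1]

/-- The `x`-variable indexed by `x : X`, inside the field of rational functions in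
the `x`-variables and the arrow variables. -/
def xx (Q1 : Type) (x : X) : FF (X ⊕ Q1) := xv (Sum.inl x)

/-- The arrow variable `t_b`. -/
def tt (X : Type) (b : Q1) : FF (X ⊕ Q1) := xv (Sum.inr b)

/-- Extension of a permutation of the `x`-variables by the identity on the arrow
variables. -/
def permExt (Q1 : Type) (σ : Equiv.Perm X) : Equiv.Perm (X ⊕ Q1) :=
  Equiv.sumCongr σ (Equiv.refl Q1)

/-- The monomial `x^β` with integer exponents. -/
def xmon (Q1 : Type) (β : X → ℤ) : FF (X ⊕ Q1) := ∏ x : X, (xx Q1 x) ^ (β x)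

/-- The staircase exponent for the variables in `S`: each variable `x ∈ S` gets the number
of variables in `S` at the same vertex that come after it (so at each vertex the variables
of `S` receive `ν - 1, ν - 2, …, 1, 0` in their listed order). -/
def rhoS (vert : X → Q0) (lt : X → X → Prop) [DecidableRel lt] (S : Finset X) : X → ℤ :=
  fun x => if x ∈ S then ((S.filter (fun y => vert y = vert x ∧ lt x y)).card : ℤ) else 0

/-- The antisymmetrizer `J• = Σ (−1)^{w•} w•` over the permutations of the variables in `S`
preserving the vertex of each variable (and fixing all other variables). -/
def Jsym (vert : X → Q0) (S : Finset X) (f : FF (X ⊕ Q1)) : FF (X ⊕ Q1) :=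
  ∑ σ ∈ Finset.univ.filter (fun σ : Equiv.Perm X =>
      (∀ x, vert (σ x) = vert x) ∧ ∀ x ∉ S, σ x = x),
    ((Equiv.Perm.sign σ : ℤˣ) : ℤ) • act (permExt Q1 σ) f

/-- The Demazure symmetrizer `D_{w₀•}(f) = J•(x^{ρ•})⁻¹ · J•(x^{ρ•} f)` over the variables
in `S`, symmetrizing at each vertex. -/
def Dem (vert : X → Q0) (lt : X → X → Prop) [DecidableRel lt] (S : Finset X)
    (f : FF (X ⊕ Q1)) : FF (X ⊕ Q1) :=
  (Jsym vert S (xmon Q1 (rhoS vert lt S)))⁻¹ * Jsym vert S (xmon Q1 (rhoS vert lt S) * f)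

/-- The subring of Laurent polynomials over `ℤ[t_b^{±1} : b ∈ Q₁]` in the `x`-variables
belonging to `S`. -/
def LaurentIn (Q1 : Type) [Fintype Q1] (S : Finset X) : Subring (FF (X ⊕ Q1)) :=
  Subring.closure
    ((fun x : X => xx Q1 x) '' ↑S ∪ (fun x : X => (xx Q1 x)⁻¹) '' ↑S
      ∪ Set.range (tt X (Q1 := Q1)) ∪ Set.range (fun b : Q1 => (tt X b)⁻¹))

/-- `f` is symmetric in the variables of `S` at each vertex. -/
def SymmOn (Q1 : Type) (vert : X → Q0) (S : Finset X) (f : FF (X ⊕ Q1)) : Prop :=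
  ∀ σ : Equiv.Perm X, (∀ x, vert (σ x) = vert x) → (∀ x ∉ S, σ x = x) →
    act (permExt Q1 σ) f = f

/-- The shuffle product `f * g` of `f` (in the variables of `A`) and `g` (in the variables
of `B`): `D_{w₀•}(f · g · ∏_b ∏_{y ∈ B, vert y = tb} ∏_{x ∈ A, vert x = hb}
(1 − t_b y/x))`. -/
def starMul (vert : X → Q0) (hd tl : Q1 → Q0) (lt : X → X → Prop) [DecidableRel lt]
    (A B : Finset X) (f g : FF (X ⊕ Q1)) : FF (X ⊕ Q1) :=
  Dem vert lt (A ∪ B) (f * g *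
    ∏ b : Q1, ∏ y ∈ B.filter (fun y => vert y = tl b), ∏ x ∈ A.filter (fun x => vert x = hd b),
      (1 - tt X b * xx Q1 y / xx Q1 x))

/-- The shuffle product `f ⋆ g` of `f` (in the variables of `A`) and `g` (in the variables
of `B`): `D_{w₀•}(f · g · ∏_b ∏_{x ∈ A, vert x = tb} ∏_{y ∈ B, vert y = hb}
(1 − t_b x/y)⁻¹)`. -/
def starGeom (vert : X → Q0) (hd tl : Q1 → Q0) (lt : X → X → Prop) [DecidableRel lt]
    (A B : Finset X) (f g : FF (X ⊕ Q1)) : FF (X ⊕ Q1) :=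
  Dem vert lt (A ∪ B) (f * g *
    ∏ b : Q1, ∏ x ∈ A.filter (fun x => vert x = tl b), ∏ y ∈ B.filter (fun y => vert y = hd b),
      (1 - tt X b * xx Q1 x / xx Q1 y)⁻¹)

end

end Shuffle

namespace QHL

open QKS Shuffle

noncomputable section

instance {m : ℕ} {a : Fin m → ℕ} : DecidableRel (fun x y : Coord m a => coordLT x y) :=
  fun _ _ => inferInstanceAs (Decidable (_ ∨ _))

variable {Q0 Q1 : Type} [Fintype Q0] [DecidableEq Q0] [Fintype Q1] [DecidableEq Q1]
variable {m : ℕ} {a : Fin m → ℕ}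

/-- The block `x(k)` of variables. -/
def blkF (m : ℕ) (a : Fin m → ℕ) (k : ℕ) : Finset (Coord m a) :=
  Finset.univ.filter (fun x => (x.1 : ℕ) = k)

/-- The variables of the blocks before block `k`. -/
def headF (m : ℕ) (a : Fin m → ℕ) (k : ℕ) : Finset (Coord m a) :=
  Finset.univ.filter (fun x => (x.1 : ℕ) < k)

/-- The Schur (Laurent) polynomial `s_{μ(k)}[x(k)] = J(x(k)^{μ(k)+ρ})/J(x(k)^ρ)` in the
variables of block `k`, realized as the Demazure symmetrizer of the monomial `x(k)^{μ(k)}`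
over the block-`k` variables. -/
def schurBlk (Q1 : Type) [Fintype Q1] [DecidableEq Q1] (iseq : Fin m → Q0)
    (mu : Coord m a → ℤ) (k : ℕ) : FF (Coord m a ⊕ Q1) :=
  Dem (fun x => iseq x.1) (fun x y => coordLT x y) (blkF m a k)
    (xmon Q1 (fun x => if (x.1 : ℕ) = k then mu x else 0))

/-- The iterated (left to right) shuffle product
`s_{μ(1)}[x(1)] ⋆ s_{μ(2)}[x(2)] ⋆ ⋯ ⋆ s_{μ(k)}[x(k)]` of the Schur polynomials of the
first `k` blocks. -/
def starAllL (hd tl : Q1 → Q0) (iseq : Fin m → Q0) (mu : Coord m a → ℤ) :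
    ℕ → FF (Coord m a ⊕ Q1)
  | 0 => 1
  | (k + 1) =>
      starGeom (fun x => iseq x.1) hd tl (fun x y => coordLT x y) (headF m a k) (blkF m a k)
        (starAllL hd tl iseq mu k) (schurBlk Q1 iseq mu k)

/-- The factor `B_{𝐢,𝐚}`, restricted to the variables in `S`:
`∏_{k<ℓ} ∏_{b : i_k → i_ℓ} ∏_{y ∈ x(k), z ∈ x(ℓ)} (1 − t_b y/z)⁻¹`. -/
def BfieldS (hd tl : Q1 → Q0) (iseq : Fin m → Q0) (a : Fin m → ℕ)
    (S : Finset (Coord m a)) : FF (Coord m a ⊕ Q1) :=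
  ∏ x ∈ S, ∏ y ∈ S, ∏ b : Q1,
    if x.1 < y.1 ∧ tl b = iseq x.1 ∧ hd b = iseq y.1
    then (1 - tt (Coord m a) b * xx Q1 x / xx Q1 y)⁻¹ else 1

/-- The quiver Hall-Littlewood series `χ^{𝐢,𝐚}_{μ(•)} = D_{w₀•}(x^{μ•} B_{𝐢,𝐚})`
(in the rational-function model), for the data restricted to the variables in `S`. -/
def chiF (hd tl : Q1 → Q0) (iseq : Fin m → Q0) (a : Fin m → ℕ) (mu : Coord m a → ℤ)
    (S : Finset (Coord m a)) : FF (Coord m a ⊕ Q1) :=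
  Dem (fun x => iseq x.1) (fun x y => coordLT x y) S
    (xmon Q1 (fun x => if x ∈ S then mu x else 0) * BfieldS hd tl iseq a S)

end

end QHL

namespace Shuffle

section Action

variable {V : Type}

lemma act_algebraMap (σ : Equiv.Perm V) (p : MvPolynomial V ℚ) :
    act σ (algebraMap _ (FF V) p) = algebraMap _ (FF V) (MvPolynomial.rename σ p) :=
  IsFractionRing.lift_algebraMap _ p

lemma act_xv (σ : Equiv.Perm V) (v : V) : act σ (xv v) = xv (σ v) := by
  simp [xv, act_algebraMap]

lemma act_mul_apply (σ τ : Equiv.Perm V) (f : FF V) : act (σ * τ) f = act σ (act τ f) := by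
  have h : act (σ * τ) = (act σ).comp (act τ) := by
    refine IsLocalization.ringHom_ext (nonZeroDivisors (MvPolynomial V ℚ)) ?_
    ext p
    · simp
    · simp [act_algebraMap]
  rw [h, RingHom.comp_apply]

lemma act_one (f : FF V) : act (1 : Equiv.Perm V) f = f := by
  have h : act (1 : Equiv.Perm V) = RingHom.id (FF V) := by
    refine IsLocalization.ringHom_ext (nonZeroDivisors (MvPolynomial V ℚ)) ?_
    ext p
    · simp
    · simp [act_algebraMap]
  rw [h, RingHom.id_apply]

lemma xv_ne_zero (v : V) : xv v ≠ 0 := by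
  unfold xv
  rw [Ne, map_eq_zero_iff _ (IsFractionRing.injective (MvPolynomial V ℚ) (FF V))]
  exact MvPolynomial.X_ne_zero v

end Action

variable {X Q0 Q1 : Type}

lemma permExt_one : permExt Q1 (1 : Equiv.Perm X) = 1 := by
  ext v; cases v <;> rfl

lemma permExt_mul (σ τ : Equiv.Perm X) :
    permExt Q1 (σ * τ) = permExt Q1 σ * permExt Q1 τ := by
  ext v; cases v <;> rfl

lemma act_permExt_mul (σ τ : Equiv.Perm X) (f : FF (X ⊕ Q1)) :
    act (permExt Q1 (σ * τ)) f = act (permExt Q1 σ) (act (permExt Q1 τ) f) := by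
  rw [permExt_mul, act_mul_apply]

lemma act_permExt_xx (σ : Equiv.Perm X) (x : X) :
    act (permExt Q1 σ) (xx Q1 x) = xx Q1 (σ x) :=
  act_xv _ _

lemma act_permExt_tt (σ : Equiv.Perm X) (b : Q1) :
    act (permExt Q1 σ) (tt X b) = tt X b :=
  act_xv _ _

/-- A permutation fixing every element outside `S` maps `S` to itself. -/
lemma apply_mem_iff {S : Finset X} {σ : Equiv.Perm X} (hσ : ∀ x ∉ S, σ x = x) (x : X) :
    σ x ∈ S ↔ x ∈ S := by
  constructor
  · intro h
    by_contra hx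
    exact hx (hσ x hx ▸ h)
  · intro h
    by_contra hx
    have := σ.injective (hσ _ hx)
    exact hx (this.symm ▸ h)

section Combinatorics

variable [DecidableEq Q0] {vert : X → Q0} {lt : X → X → Prop} [DecidableRel lt]
  {S A B : Finset X}

/-- The kernel of the shuffle product is invariant under permutations preserving the vertices and both
sets of variables. -/
lemma act_permExt_kernel [Fintype Q1] (hd tl : Q1 → Q0) {σ : Equiv.Perm X}
    (hv : ∀ x, vert (σ x) = vert x) (hA : ∀ x, σ x ∈ A ↔ x ∈ A) (hB : ∀ x, σ x ∈ B ↔ x ∈ B) :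
    act (permExt Q1 σ) (∏ b : Q1, ∏ x ∈ A.filter (fun x => vert x = tl b),
      ∏ y ∈ B.filter (fun y => vert y = hd b), (1 - tt X b * xx Q1 x / xx Q1 y)⁻¹) =
    ∏ b : Q1, ∏ x ∈ A.filter (fun x => vert x = tl b),
      ∏ y ∈ B.filter (fun y => vert y = hd b), (1 - tt X b * xx Q1 x / xx Q1 y)⁻¹ := by
  rw [map_prod]
  refine Finset.prod_congr rfl fun b _ => ?_
  rw [map_prod]
  refine Finset.prod_equiv σ (by simp [hA, hv]) fun x _ => ?_
  rw [map_prod]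
  refine Finset.prod_equiv σ (by simp [hB, hv]) fun y _ => ?_
  simp [act_permExt_xx, act_permExt_tt]

variable [DecidableEq X]

/-- The staircase separates the variables of `S` at each vertex. -/
lemma rhoS_ne_of_lt (hirr : ∀ x, ¬ lt x x) (htrans : ∀ x y z, lt x y → lt y z → lt x z)
    {x y : X} (hx : x ∈ S) (hy : y ∈ S) (hv : vert y = vert x) (hlt : lt x y) :
    rhoS vert lt S y ≠ rhoS vert lt S x := by
  unfold rhoS
  rw [if_pos hx, if_pos hy, Ne, Nat.cast_inj]
  refine (Finset.card_lt_card ?_).ne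
  rw [Finset.ssubset_iff_of_subset]
  · exact ⟨y, by simp [hy, hv, hlt], by simp [hirr]⟩
  · intro z
    simp only [Finset.mem_filter, hv]
    exact fun h => ⟨h.1, h.2.1, htrans _ _ _ hlt h.2.2⟩

/-- Permuting variables outside `S` does not change the staircase of `S`. -/
lemma rhoS_apply_of_disjoint {σ : Equiv.Perm X} (hσ : ∀ x ∈ S, σ x = x) (x : X) :
    rhoS vert lt S (σ x) = rhoS vert lt S x := by
  by_cases hx : x ∈ S
  · rw [hσ x hx]
  · have : σ x ∉ S := fun h => hx (σ.injective (hσ _ h) ▸ h)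
    simp [rhoS, hx, this]

lemma rhoS_union_of_mem_left (hlt : ∀ x ∈ A, ∀ y ∈ B, lt x y) (hdisj : Disjoint A B)
    {x : X} (hx : x ∈ A) :
    rhoS vert lt (A ∪ B) x - rhoS vert lt A x = (B.filter (fun y => vert y = vert x)).card := by
  unfold rhoS
  rw [if_pos hx, if_pos (Finset.mem_union_left _ hx), Finset.filter_union,
    Finset.card_union_of_disjoint (Finset.disjoint_filter_filter hdisj),
    Finset.filter_congr (s := B) (q := fun y => vert y = vert x) (by simp +contextual [hlt x hx])]
  push_cast
  ring

lemma rhoS_union_of_mem_right (hlt : ∀ x ∈ A, ∀ y ∈ B, ¬ lt y x) {y : X} (hy : y ∈ B) :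
    rhoS vert lt (A ∪ B) y = rhoS vert lt B y := by
  unfold rhoS
  rw [if_pos hy, if_pos (Finset.mem_union_right _ hy), Finset.filter_union,
    Finset.filter_false_of_mem (s := A) (by simp +contextual [fun x hx => hlt x hx y hy]),
    Finset.empty_union]

end Combinatorics

variable [Fintype X]

lemma xmon_add (β γ : X → ℤ) : xmon Q1 (fun x => β x + γ x) = xmon Q1 β * xmon Q1 γ := by
  unfold xmon
  rw [← Finset.prod_mul_distrib]
  exact Finset.prod_congr rfl fun x _ => zpow_add₀ (xv_ne_zero _) _ _

lemma xmon_zero : xmon Q1 (fun _ : X => 0) = 1 := by simp [xmon]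

lemma act_permExt_xmon (σ : Equiv.Perm X) (β : X → ℤ) :
    act (permExt Q1 σ) (xmon Q1 β) = xmon Q1 (fun x => β (σ⁻¹ x)) := by
  unfold xmon
  rw [map_prod, ← Equiv.prod_comp σ (fun x => xx Q1 x ^ β (σ⁻¹ x))]
  exact Finset.prod_congr rfl fun x _ => by simp [act_permExt_xx]

lemma act_permExt_xmon_of_invariant {σ : Equiv.Perm X} {β : X → ℤ} (h : ∀ x, β (σ x) = β x) :
    act (permExt Q1 σ) (xmon Q1 β) = xmon Q1 β := by
  rw [act_permExt_xmon]
  congr 1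
  ext x
  simpa using (h (σ⁻¹ x)).symm

/-- A monomial with natural exponents is the image of a polynomial monomial. -/
lemma xmon_natCast [Finite Q1] (n : X → ℕ) :
    xmon Q1 (fun x => (n x : ℤ)) = algebraMap (MvPolynomial (X ⊕ Q1) ℚ) _
      (MvPolynomial.monomial (Finsupp.equivFunOnFinite.symm (Sum.elim n 0)) 1) := by
  have := Fintype.ofFinite Q1
  rw [MvPolynomial.monomial_eq, Finsupp.prod_fintype _ _ (by simp)]
  simp [xmon, xx, xv, Fintype.prod_sum_type]

variable [DecidableEq X] [DecidableEq Q0]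

section Antisymmetrizer

variable {vert : X → Q0} {S : Finset X}

lemma Jsym_eq_sum_mul (f : FF (X ⊕ Q1)) :
    Jsym vert S f = ∑ σ ∈ Finset.univ.filter (fun σ : Equiv.Perm X =>
      (∀ x, vert (σ x) = vert x) ∧ ∀ x ∉ S, σ x = x),
      (((Equiv.Perm.sign σ : ℤˣ) : ℤ) : FF (X ⊕ Q1)) * act (permExt Q1 σ) f := by
  unfold Jsym
  refine Finset.sum_congr rfl fun σ _ => ?_
  rcases Int.units_eq_one_or (Equiv.Perm.sign σ) with h | h <;> simp [h]

lemma Jsym_act {σ : Equiv.Perm X} (hv : ∀ x, vert (σ x) = vert x) (hσ : ∀ x ∉ S, σ x = x)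
    (f : FF (X ⊕ Q1)) :
    Jsym vert S (act (permExt Q1 σ) f) = (((Equiv.Perm.sign σ : ℤˣ) : ℤ) : FF (X ⊕ Q1)) * Jsym vert S f := by
  rw [Jsym_eq_sum_mul, Jsym_eq_sum_mul, Finset.mul_sum]
  refine Finset.sum_equiv (Equiv.mulRight σ) ?_ ?_
  · intro τ
    simp only [Finset.mem_filter_univ, Equiv.coe_mulRight, Equiv.Perm.mul_apply]
    constructor
    · rintro ⟨h1, h2⟩
      exact ⟨fun x => (h1 _).trans (hv x), fun x hx => by rw [hσ x hx, h2 x hx]⟩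
    · rintro ⟨h1, h2⟩
      refine ⟨fun x => ?_, fun x hx => ?_⟩
      · obtain ⟨y, rfl⟩ := σ.surjective x
        rw [h1, hv]
      · simpa [hσ x hx] using h2 x hx
  · intro τ _
    simp only [Equiv.coe_mulRight, Equiv.Perm.sign_mul, act_permExt_mul]
    rcases Int.units_eq_one_or (Equiv.Perm.sign σ) with h | h <;> simp [h]

/-- The antisymmetrizer is antisymmetric. -/
lemma act_Jsym {σ : Equiv.Perm X} (hv : ∀ x, vert (σ x) = vert x) (hσ : ∀ x ∉ S, σ x = x)
    (f : FF (X ⊕ Q1)) :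
    act (permExt Q1 σ) (Jsym vert S f) = (((Equiv.Perm.sign σ : ℤˣ) : ℤ) : FF (X ⊕ Q1)) * Jsym vert S f := by
  rw [Jsym_eq_sum_mul, Finset.mul_sum, map_sum]
  refine Finset.sum_equiv (Equiv.mulLeft σ) ?_ ?_
  · intro τ
    simp only [Finset.mem_filter_univ, Equiv.coe_mulLeft, Equiv.Perm.mul_apply, hv]
    refine and_congr_right fun _ => forall₂_congr fun x hx => ?_
    rw [← σ.injective.eq_iff, hσ x hx]
  · intro τ _
    simp only [Equiv.coe_mulLeft, act_permExt_mul, map_mul, map_intCast]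
    rcases Int.units_eq_one_or (Equiv.Perm.sign σ) with h | h <;> simp [h]

/-- Invariant factors can be pulled out of the antisymmetrizer. -/
lemma Jsym_mul_left {h : FF (X ⊕ Q1)} (hh : SymmOn Q1 vert S h) (f : FF (X ⊕ Q1)) :
    Jsym vert S (h * f) = h * Jsym vert S f := by
  rw [Jsym_eq_sum_mul, Jsym_eq_sum_mul, Finset.mul_sum]
  refine Finset.sum_congr rfl fun σ hσ => ?_
  rw [Finset.mem_filter_univ] at hσ
  rw [map_mul, hh σ hσ.1 hσ.2, mul_left_comm]

/-- The antisymmetrizer in the variables of `S` commutes with permutations of the other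
variables. -/
lemma act_Jsym_of_disjoint {σ : Equiv.Perm X} (hσ : ∀ x ∈ S, σ x = x) (f : FF (X ⊕ Q1)) :
    act (permExt Q1 σ) (Jsym vert S f) = Jsym vert S (act (permExt Q1 σ) f) := by
  rw [Jsym_eq_sum_mul, Jsym_eq_sum_mul, map_sum]
  refine Finset.sum_congr rfl fun τ hτ => ?_
  rw [Finset.mem_filter_univ] at hτ
  have hcomm : σ * τ = τ * σ := by
    refine Equiv.Perm.Disjoint.commute fun x => ?_
    by_cases hx : x ∈ S
    · exact Or.inl (hσ x hx)
    · exact Or.inr (hτ.2 x hx)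
  rw [map_mul, map_intCast, ← act_permExt_mul, ← act_permExt_mul, hcomm]

lemma Jsym_empty (f : FF (X ⊕ Q1)) : Jsym vert ∅ f = f := by
  unfold Jsym
  have : Finset.univ.filter (fun σ : Equiv.Perm X =>
      (∀ x, vert (σ x) = vert x) ∧ ∀ x ∉ (∅ : Finset X), σ x = x) = {1} := by
    ext σ
    simp only [Finset.mem_filter_univ, Finset.mem_singleton, Finset.notMem_empty,
      not_false_eq_true, forall_const]
    constructor
    · rintro ⟨_, h⟩
      exact Equiv.ext h
    · rintro rfl
      simp
  rw [this]
  simp [permExt_one, act_one]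

end Antisymmetrizer

section Staircase

variable {vert : X → Q0} {lt : X → X → Prop} [DecidableRel lt] {S : Finset X}

lemma Jsym_xmon_rhoS_ne_zero [Finite Q1] (hirr : ∀ x, ¬ lt x x)
    (htrans : ∀ x y z, lt x y → lt y z → lt x z) (htri : ∀ x y, lt x y ∨ x = y ∨ lt y x) :
    Jsym vert S (xmon Q1 (rhoS vert lt S)) ≠ 0 := by
  obtain ⟨n, hn⟩ : ∃ n : X → ℕ, rhoS vert lt S = fun x => (n x : ℤ) :=
    ⟨fun x => if x ∈ S then (S.filter (fun y => vert y = vert x ∧ lt x y)).card else 0, by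
      ext x; simp [rhoS]⟩
  have key : Jsym vert S (xmon Q1 (rhoS vert lt S)) =
      algebraMap (MvPolynomial (X ⊕ Q1) ℚ) _
        (∑ σ ∈ Finset.univ.filter (fun σ : Equiv.Perm X =>
          (∀ x, vert (σ x) = vert x) ∧ ∀ x ∉ S, σ x = x),
          MvPolynomial.C (((Equiv.Perm.sign σ : ℤˣ) : ℤ) : ℚ) * MvPolynomial.monomial
            (Finsupp.equivFunOnFinite.symm (Sum.elim (fun x => n (σ⁻¹ x)) 0)) 1) := by
    rw [Jsym_eq_sum_mul, map_sum]
    refine Finset.sum_congr rfl fun σ _ => ?_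
    rw [map_mul, map_intCast, map_intCast, hn, act_permExt_xmon, xmon_natCast (fun x => n (σ⁻¹ x))]
  rw [key, Ne, map_eq_zero_iff _ (IsFractionRing.injective (MvPolynomial (X ⊕ Q1) ℚ) _)]
  intro h0
  classical
  have hc := congrArg (MvPolynomial.coeff (Finsupp.equivFunOnFinite.symm (Sum.elim n 0))) h0
  rw [MvPolynomial.coeff_sum, Finset.sum_eq_single 1] at hc
  · simp [MvPolynomial.coeff_monomial] at hc
  · intro σ hσ hne
    rw [Finset.mem_filter_univ] at hσ
    rw [MvPolynomial.coeff_C_mul, MvPolynomial.coeff_monomial, if_neg, mul_zero]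
    intro heq
    apply hne
    have heq' := Finsupp.equivFunOnFinite.symm.injective heq
    ext x
    have hnx : rhoS vert lt S (σ x) = rhoS vert lt S x := by
      have := congrFun heq' (Sum.inl (σ x))
      simp only [Sum.elim_inl, Equiv.Perm.inv_def, Equiv.symm_apply_apply] at this
      rw [hn]
      exact congrArg _ this.symm
    by_cases hx : x ∈ S
    · have hx' := (apply_mem_iff hσ.2 x).2 hx
      rcases htri x (σ x) with h | h | h
      · exact absurd hnx (rhoS_ne_of_lt hirr htrans hx hx' (hσ.1 x) h)
      · exact h.symm
      · exact absurd hnx.symm (rhoS_ne_of_lt hirr htrans hx' hx (hσ.1 x).symm h)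
    · exact hσ.2 x hx
  · intro h
    simp at h

end Staircase

section Demazure

variable {vert : X → Q0} {lt : X → X → Prop} [DecidableRel lt]

lemma Dem_empty (f : FF (X ⊕ Q1)) : Dem vert lt ∅ f = f := by
  have h : xmon Q1 (rhoS vert lt ∅) = 1 := by simp [xmon, rhoS]
  simp [Dem, Jsym_empty, h]

/-- The Demazure symmetrizer in the variables of `S` preserves invariance under
permutations of the other variables. -/
lemma act_Dem_of_disjoint {S : Finset X} {σ : Equiv.Perm X} (hσ : ∀ x ∈ S, σ x = x)
    {f : FF (X ⊕ Q1)} (hf : act (permExt Q1 σ) f = f) :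
    act (permExt Q1 σ) (Dem vert lt S f) = Dem vert lt S f := by
  have hρ := act_permExt_xmon_of_invariant (Q1 := Q1)
    (rhoS_apply_of_disjoint (vert := vert) (lt := lt) hσ)
  unfold Dem
  rw [map_mul, map_inv₀, act_Jsym_of_disjoint hσ, act_Jsym_of_disjoint hσ, map_mul, hρ, hf]

/-- The Demazure symmetrizer as an unsigned sum over permutations. -/
lemma Dem_eq_sum (S : Finset X) (f : FF (X ⊕ Q1)) :
    Dem vert lt S f = ∑ σ ∈ Finset.univ.filter (fun σ : Equiv.Perm X =>
      (∀ x, vert (σ x) = vert x) ∧ ∀ x ∉ S, σ x = x),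
      act (permExt Q1 σ) ((Jsym vert S (xmon Q1 (rhoS vert lt S)))⁻¹ *
        (xmon Q1 (rhoS vert lt S) * f)) := by
  unfold Dem
  conv_lhs => rw [Jsym_eq_sum_mul (f := _ * f), Finset.mul_sum]
  refine Finset.sum_congr rfl fun σ hσ => ?_
  rw [Finset.mem_filter_univ] at hσ
  rw [map_mul _ _⁻¹, map_inv₀, act_Jsym hσ.1 hσ.2]
  rcases Int.units_eq_one_or (Equiv.Perm.sign σ) with h | h <;> simp [h]

/-- A partial Demazure symmetrizer, multiplied by an invariant factor, is absorbed by a larger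
Demazure symmetrizer whose staircase restricts to the smaller one up to a shift constant at
each vertex. -/
lemma Dem_Dem_mul {A S : Finset X} (hAS : A ⊆ S)
    (hρ : ∀ x ∈ A, ∀ y ∈ A, vert x = vert y →
      rhoS vert lt S x - rhoS vert lt A x = rhoS vert lt S y - rhoS vert lt A y)
    (hJ : Jsym vert A (xmon Q1 (rhoS vert lt A)) ≠ 0)
    {h : FF (X ⊕ Q1)} (hh : SymmOn Q1 vert A h) (f : FF (X ⊕ Q1)) :
    Dem vert lt S (Dem vert lt A f * h) = Dem vert lt S (f * h) := by
  set δ : X → ℤ := fun x => rhoS vert lt S x - rhoS vert lt A x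
  have hδ : SymmOn Q1 vert A (xmon Q1 δ) := by
    intro σ hv hσ
    refine act_permExt_xmon_of_invariant fun x => ?_
    by_cases hx : x ∈ A
    · exact hρ _ ((apply_mem_iff hσ x).2 hx) _ hx (hv x)
    · rw [hσ x hx]
  have hsplit : xmon Q1 (rhoS vert lt S) = xmon Q1 δ * xmon Q1 (rhoS vert lt A) := by
    rw [← xmon_add]; simp [δ]
  have hJadd : ∀ (T : Finset (Equiv.Perm X)) (g : Equiv.Perm X → FF (X ⊕ Q1)),
      Jsym vert S (∑ σ ∈ T, g σ) = ∑ σ ∈ T, Jsym vert S (g σ) := by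
    intro T g
    simp only [Jsym_eq_sum_mul, map_sum, Finset.mul_sum]
    rw [Finset.sum_comm]
  set J := Jsym vert A (xmon Q1 (rhoS vert lt A)) with hJdef
  unfold Dem
  congr 1
  change Jsym vert S (xmon Q1 (rhoS vert lt S) * (Dem vert lt A f * h)) = _
  rw [Dem_eq_sum, Finset.sum_mul, Finset.mul_sum, hJadd, ← hJdef]
  -- each summand is moved, up to sign, to a permutation of the large staircase
  have hterm : ∀ σ ∈ Finset.univ.filter (fun σ : Equiv.Perm X =>
      (∀ x, vert (σ x) = vert x) ∧ ∀ x ∉ A, σ x = x),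
      Jsym vert S (xmon Q1 (rhoS vert lt S) *
        (act (permExt Q1 σ) (J⁻¹ * (xmon Q1 (rhoS vert lt A) * f)) * h)) =
      Jsym vert S ((((Equiv.Perm.sign σ⁻¹ : ℤˣ) : ℤ) : FF (X ⊕ Q1)) *
        act (permExt Q1 σ⁻¹) (xmon Q1 (rhoS vert lt S)) *
          (J⁻¹ * (xmon Q1 (rhoS vert lt A) * f) * h)) := by
    intro σ hσ
    rw [Finset.mem_filter_univ] at hσ
    have hprod : xmon Q1 (rhoS vert lt S) *
        (act (permExt Q1 σ) (J⁻¹ * (xmon Q1 (rhoS vert lt A) * f)) * h) =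
        act (permExt Q1 σ) (act (permExt Q1 σ⁻¹) (xmon Q1 (rhoS vert lt S)) *
          (J⁻¹ * (xmon Q1 (rhoS vert lt A) * f) * h)) := by
      rw [map_mul (act (permExt Q1 σ)) (act (permExt Q1 σ⁻¹) _), ← act_permExt_mul,
        mul_inv_cancel, permExt_one, act_one, map_mul (act (permExt Q1 σ)) _ h,
        hh σ hσ.1 hσ.2]
    rw [hprod, Jsym_act hσ.1 fun x hx => hσ.2 x fun h => hx (hAS h)]
    rcases Int.units_eq_one_or (Equiv.Perm.sign σ) with h | h <;> simp [h, Jsym_eq_sum_mul]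
  rw [Finset.sum_congr rfl hterm, ← hJadd, ← Finset.sum_mul]
  congr 1
  have hsum : ∑ σ ∈ Finset.univ.filter (fun σ : Equiv.Perm X =>
      (∀ x, vert (σ x) = vert x) ∧ ∀ x ∉ A, σ x = x),
      (((Equiv.Perm.sign σ⁻¹ : ℤˣ) : ℤ) : FF (X ⊕ Q1)) *
        act (permExt Q1 σ⁻¹) (xmon Q1 (rhoS vert lt S)) = xmon Q1 δ * J := by
    rw [hJdef, ← Jsym_mul_left hδ, ← hsplit, Jsym_eq_sum_mul]
    refine Finset.sum_equiv (Equiv.inv _) ?_ fun σ _ => rfl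
    intro σ
    simp only [Finset.mem_filter_univ, Equiv.inv_apply, Equiv.Perm.inv_eq_iff_eq]
    refine and_congr ⟨fun h x => ?_, fun h x => ?_⟩
      (forall₂_congr fun x _ => eq_comm)
    · simpa using (h (σ⁻¹ x)).symm
    · simpa using (h (σ x)).symm
  rw [hsum, hsplit]
  field_simp

end Demazure

end Shuffle

namespace QHL

open QKS Shuffle

variable {Q0 Q1 : Type}
variable {m : ℕ} {a : Fin m → ℕ}

lemma coordLT_irrefl (x : Coord m a) : ¬ coordLT x x := by simp [coordLT]

lemma coordLT_trans (x y z : Coord m a) (hxy : coordLT x y) (hyz : coordLT y z) :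
    coordLT x z := by
  unfold coordLT at *
  simp only [Fin.lt_def, Fin.ext_iff] at *
  omega

lemma coordLT_trichotomy (x y : Coord m a) : coordLT x y ∨ x = y ∨ coordLT y x := by
  obtain ⟨k, p⟩ := x
  obtain ⟨l, q⟩ := y
  rcases lt_trichotomy k l with h | rfl | h
  · exact Or.inl (Or.inl h)
  · rcases lt_trichotomy p q with h | rfl | h
    · exact Or.inl (Or.inr ⟨rfl, h⟩)
    · exact Or.inr (Or.inl rfl)
    · exact Or.inr (Or.inr (Or.inr ⟨rfl, h⟩))
  · exact Or.inr (Or.inr (Or.inl h))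

lemma headF_union_blkF (k : ℕ) : headF m a k ∪ blkF m a k = headF m a (k + 1) := by
  ext x
  simp [headF, blkF]
  omega

lemma disjoint_headF_blkF (k : ℕ) : Disjoint (headF m a k) (blkF m a k) := by
  rw [Finset.disjoint_left]
  simp +contextual [headF, blkF, ne_of_lt]

lemma coordLT_of_mem_headF_blkF {k : ℕ} {x y : Coord m a} (hx : x ∈ headF m a k)
    (hy : y ∈ blkF m a k) : coordLT x y := by
  simp only [headF, blkF, Finset.mem_filter_univ] at hx hy
  exact Or.inl (Fin.lt_def.2 (hy ▸ hx))

lemma xmon_headF_succ (mu : Coord m a → ℤ) (k : ℕ) :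
    xmon Q1 (fun x => if x ∈ headF m a (k + 1) then mu x else 0) =
      xmon Q1 (fun x => if x ∈ headF m a k then mu x else 0) *
        xmon Q1 (fun x => if (x.1 : ℕ) = k then mu x else 0) := by
  rw [← xmon_add]
  congr 1
  ext x
  simp only [headF, Finset.mem_filter_univ]
  split_ifs <;> omega

lemma act_xmon_ite_of_fixed {S : Finset (Coord m a)} (mu : Coord m a → ℤ)
    {σ : Equiv.Perm (Coord m a)} (hσ : ∀ x ∈ S, σ x = x) :
    act (permExt Q1 σ) (xmon Q1 (fun x => if x ∈ S then mu x else 0)) =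
      xmon Q1 (fun x => if x ∈ S then mu x else 0) := by
  refine act_permExt_xmon_of_invariant fun x => ?_
  by_cases hx : x ∈ S
  · rw [hσ x hx]
  · have : σ x ∉ S := fun h => hx (σ.injective (hσ _ h) ▸ h)
    simp [hx, this]

variable [DecidableEq Q0] [Fintype Q1]

lemma BfieldS_headF_succ (hd tl : Q1 → Q0) (iseq : Fin m → Q0) (k : ℕ) :
    BfieldS hd tl iseq a (headF m a (k + 1)) = BfieldS hd tl iseq a (headF m a k) *
      ∏ b : Q1, ∏ x ∈ (headF m a k).filter (fun x => iseq x.1 = tl b),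
        ∏ y ∈ (blkF m a k).filter (fun y => iseq y.1 = hd b),
          (1 - tt (Coord m a) b * xx Q1 x / xx Q1 y)⁻¹ := by
  have hright : ∀ x ∈ blkF m a k, (∏ y ∈ headF m a (k + 1), ∏ b : Q1,
      if x.1 < y.1 ∧ tl b = iseq x.1 ∧ hd b = iseq y.1
      then (1 - tt (Coord m a) b * xx Q1 x / xx Q1 y)⁻¹ else 1) = 1 := by
    intro x hx
    refine Finset.prod_eq_one fun y hy => Finset.prod_eq_one fun b _ => if_neg ?_
    simp only [headF, blkF, Finset.mem_filter_univ] at hx hy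
    rw [Fin.lt_def]
    omega
  unfold BfieldS
  rw [← headF_union_blkF, Finset.prod_union (disjoint_headF_blkF k), headF_union_blkF,
    Finset.prod_congr rfl hright, Finset.prod_const_one, mul_one, ← headF_union_blkF]
  simp only [Finset.prod_union (disjoint_headF_blkF k), Finset.prod_mul_distrib]
  congr 1
  simp only [Finset.prod_filter]
  rw [Finset.prod_comm]
  conv_lhs => enter [2, y]; rw [Finset.prod_comm]
  rw [Finset.prod_comm]
  refine Finset.prod_congr rfl fun b _ => ?_
  rw [Finset.prod_comm]
  refine Finset.prod_congr rfl fun x hx => ?_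
  split_ifs with h
  · refine Finset.prod_congr rfl fun y hy => ?_
    have hlt : x.1 < y.1 := by
      simp only [headF, blkF, Finset.mem_filter_univ] at hx hy
      exact Fin.lt_def.2 (hy ▸ hx)
    simp [hlt, h, eq_comm]
  · exact Finset.prod_eq_one fun y _ => if_neg fun h' => h h'.2.1.symm

lemma act_BfieldS_of_fixed (hd tl : Q1 → Q0) (iseq : Fin m → Q0) {S : Finset (Coord m a)}
    {σ : Equiv.Perm (Coord m a)} (hσ : ∀ x ∈ S, σ x = x) :
    act (permExt Q1 σ) (BfieldS hd tl iseq a S) = BfieldS hd tl iseq a S := by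
  unfold BfieldS
  simp only [map_prod]
  refine Finset.prod_congr rfl fun x hx => Finset.prod_congr rfl fun y hy =>
    Finset.prod_congr rfl fun b _ => ?_
  split_ifs
  · simp [act_permExt_xx, act_permExt_tt, hσ x hx, hσ y hy]
  · exact map_one _

/-- The series of the first `k` blocks is the iterated shuffle product of `k` factors. -/
lemma chiF_headF [DecidableEq Q1] (hd tl : Q1 → Q0) (iseq : Fin m → Q0) (mu : Coord m a → ℤ) (k : ℕ) :
    chiF hd tl iseq a mu (headF m a k) = starAllL hd tl iseq mu k := by
  induction k with
  | zero =>
    have h : headF m a 0 = ∅ := by simp [headF]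
    simp [chiF, starAllL, h, Dem_empty, BfieldS, xmon_zero]
  | succ k ih =>
    have hdisj := disjoint_headF_blkF (m := m) (a := a) k
    have hlt : ∀ x ∈ headF m a k, ∀ y ∈ blkF m a k, coordLT x y :=
      fun x hx y hy => coordLT_of_mem_headF_blkF hx hy
    have hJ : ∀ S : Finset (Coord m a), Jsym (fun x => iseq x.1) S
        (xmon Q1 (rhoS (fun x => iseq x.1) (fun x y => coordLT x y) S)) ≠ 0 := fun S =>
      Jsym_xmon_rhoS_ne_zero coordLT_irrefl coordLT_trans coordLT_trichotomy
    have hmem : ∀ {S T : Finset (Coord m a)} {σ : Equiv.Perm (Coord m a)}, Disjoint S T →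
        (∀ x ∉ S, σ x = x) → ∀ x ∈ T, σ x = x :=
      fun hST hσ x hx => hσ x fun h => Finset.disjoint_left.1 hST h hx
    have hmem_iff : ∀ {T : Finset (Coord m a)} {σ : Equiv.Perm (Coord m a)},
        (∀ x ∈ T, σ x = x) → ∀ x, σ x ∈ T ↔ x ∈ T := fun {T σ} hσ x =>
      ⟨fun h => σ.injective (hσ _ h) ▸ h, fun h => (hσ x h).symm ▸ h⟩
    have hblk : (fun x : Coord m a => if (x.1 : ℕ) = k then mu x else 0) =
        fun x => if x ∈ blkF m a k then mu x else 0 := by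
      simp [blkF]
    rw [starAllL, ← ih, starGeom, chiF, chiF, mul_assoc, Dem_Dem_mul Finset.subset_union_left
      _ (hJ _), schurBlk, mul_left_comm, Dem_Dem_mul Finset.subset_union_right _ (hJ _),
      BfieldS_headF_succ, xmon_headF_succ, headF_union_blkF]
    · congr 1
      ring
    · intro σ hv hσ
      have hσ' := hmem hdisj.symm hσ
      rw [map_mul, map_mul, act_xmon_ite_of_fixed mu hσ', act_BfieldS_of_fixed hd tl iseq hσ',
        act_permExt_kernel hd tl hv (hmem_iff hσ') (apply_mem_iff hσ)]
    · intro x hx y hy _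
      have hnlt : ∀ x ∈ headF m a k, ∀ y ∈ blkF m a k, ¬ coordLT y x :=
        fun x hx y hy h => coordLT_irrefl _ (coordLT_trans _ _ _ h (hlt x hx y hy))
      rw [rhoS_union_of_mem_right hnlt hx, rhoS_union_of_mem_right hnlt hy, sub_self, sub_self]
    · intro σ hv hσ
      have hσ' := hmem hdisj hσ
      rw [map_mul, schurBlk, hblk, act_Dem_of_disjoint hσ' (act_xmon_ite_of_fixed mu hσ'),
        act_permExt_kernel hd tl hv (apply_mem_iff hσ) (hmem_iff hσ')]
    · intro x hx y hy hxy
      rw [rhoS_union_of_mem_left hlt hdisj hx, rhoS_union_of_mem_left hlt hdisj hy, hxy]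

end QHL

open QKS Shuffle QHL in
/-- the quiver Hall-Littlewood series is the iterated (left to right)
shuffle product of the Schur polynomials of the blocks:
`χ^{𝐢,𝐚}_{μ(•)} = s_{μ(1)}[x(1)] ⋆ s_{μ(2)}[x(2)] ⋆ ⋯ ⋆ s_{μ(m)}[x(m)]`. -/
theorem stmt_13
    (Q0 Q1 : Type) [Fintype Q0] [DecidableEq Q0] [Fintype Q1] [DecidableEq Q1]
    (hd tl : Q1 → Q0)
    (m : ℕ) (iseq : Fin m → Q0) (a : Fin m → ℕ) (ha : ∀ k, 0 < a k)
    (mu : Coord m a → ℤ) (hmu : BlockDecreasing mu) :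
    chiF hd tl iseq a mu Finset.univ = starAllL hd tl iseq mu m := by
  have h : headF m a m = Finset.univ := by simp [headF]
  rw [← chiF_headF, h]
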